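/- Suppose m = m(n) with m, n → ∞, let p = p(n) := m/C(n,2), and assume liminf_n p(n) > 0. For each n fix two distinct vertices s, a of ⃗G(n,m). Then P(s↛a) = 2·q(n−1; n, m) + O(n(1−p/2)^{2n}), and consequently P(s↛a) ∼ 2(1 − p/2)^{n−1}·exp(−p(1−p)/(2−p)²), i.e. the ratio of the two sides tends to 1 as n → ∞. -/

import Mathlib

open Filter Real

/-- Edges of the complete graph on `Fin n`: ordered pairs `(u,v)` with `u < v`. -/
abbrev Edge (n : ℕ) : Type := {e : Fin n × Fin n // e.1 < e.2}

/-- A configuration of the random edge-orientation model: for each pair `u < v`,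
`none` means no edge, `some true` means the directed edge `u → v`, and
`some false` means the directed edge `v → u`. -/
abbrev Config (n : ℕ) : Type := Edge n → Option Bool

/-- The directed edge relation determined by a configuration. -/
def DirEdge {n : ℕ} (f : Config n) (u v : Fin n) : Prop :=
  (∃ h : u < v, f ⟨(u, v), h⟩ = some true) ∨ (∃ h : v < u, f ⟨(v, u), h⟩ = some false)

/-- `Reaches f u v`: the configuration `f` contains a directed path from `u` to `v`
(paths of length `0` are allowed, so `Reaches f u u` always holds). -/
def Reaches {n : ℕ} (f : Config n) (u v : Fin n) : Prop :=
  Relation.ReflTransGen (DirEdge f) u v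

/-- The probability of an event under a weight function on a finite sample space. -/
noncomputable def prWeight {α : Type*} [Fintype α] (w : α → ℝ) (E : Set α) : ℝ :=
  ∑ x, E.indicator w x

/-- The weight of one edge state in `⃗G(n,p)`: no edge has probability `1 - p`
and each of the two orientations has probability `p/2`. -/
noncomputable def edgeWeight (p : ℝ) : Option Bool → ℝ
  | none => 1 - p
  | some _ => p / 2

/-- The probability of an event in the random directed graph `⃗G(n,p)`. -/
noncomputable def PrGnp (n : ℕ) (p : ℝ) (E : Set (Config n)) : ℝ :=
  prWeight (fun f => ∏ e : Edge n, edgeWeight p (f e)) E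

/-- The number of present edges of a configuration. -/
def edgeCount {n : ℕ} (f : Config n) : ℕ :=
  (Finset.univ.filter fun e : Edge n => (f e).isSome).card

/-- The probability of an event in the random directed graph `⃗G(n,m)`:
the underlying graph is uniform among the graphs with exactly `m` edges, and each
present edge is oriented in one of its two directions with probability `1/2`,
independently over edges. -/
noncomputable def PrGnm (n m : ℕ) (E : Set (Config n)) : ℝ :=
  prWeight (fun f => if edgeCount f = m
      then ((Nat.choose (Nat.choose n 2) m : ℝ) * 2 ^ m)⁻¹ else 0) E

/-- Binomial transform of a sequence. -/
noncomputable def binomialSum (a : ℕ → ℝ) (l : ℕ) : ℝ :=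
  ∑ i ∈ Finset.range (l + 1), (l.choose i : ℝ) * a i

lemma binomialSum_succ (a : ℕ → ℝ) (l : ℕ) :
    binomialSum a (l + 1) = binomialSum a l + binomialSum (fun i => a (i + 1)) l := by
  unfold binomialSum
  rw [Finset.sum_range_succ' _ (l + 1)]
  simp only [Nat.choose_succ_succ, Nat.cast_add, add_mul, Finset.sum_add_distrib]
  have h : ∑ i ∈ Finset.range (l + 1), (l.choose i : ℝ) * a i =
      ∑ i ∈ Finset.range (l + 1), (l.choose (i + 1) : ℝ) * a (i + 1) + a 0 := by
    have := Finset.sum_range_succ' (fun i => (l.choose i : ℝ) * a i) (l + 1)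
    rw [Finset.sum_range_succ] at this
    simpa using this
  rw [h]
  simp
  ring

lemma sum_id_mul_choose_mul (b : ℕ → ℝ) (k : ℕ) :
    ∑ i ∈ Finset.range (k + 2), (i : ℝ) * (((k + 1).choose i : ℝ) * b i) =
      ((k : ℝ) + 1) * binomialSum (fun i => b (i + 1)) k := by
  rw [Finset.sum_range_succ', binomialSum, Finset.mul_sum]
  simp only [Nat.cast_zero, zero_mul, add_zero]
  refine Finset.sum_congr rfl fun i _ => ?_
  have h : ((k : ℝ) + 1) * (k.choose i : ℝ) = ((k + 1).choose (i + 1) : ℝ) * ((i : ℝ) + 1) := by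
    exact_mod_cast Nat.add_one_mul_choose_eq k i
  push_cast
  linear_combination (-b (i + 1)) * h

/-- If `(N - i) a (i+1) = (M - i) a i` for small `i`, its binomial transform satisfies a
three-term recurrence. -/
lemma binomialSum_recurrence (a : ℕ → ℝ) (N M : ℝ) (k : ℕ)
    (h : ∀ i ≤ k + 1, (N - i) * a (i + 1) = (M - i) * a i) :
    (N - (k + 1)) * binomialSum a (k + 2) =
      (N + M - 3 * (k + 1)) * binomialSum a (k + 1) + 2 * (k + 1) * binomialSum a k := by
  have h0 : ∑ i ∈ Finset.range (k + 2), ((k + 1).choose i : ℝ) * ((N - i) * a (i + 1)) =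
      ∑ i ∈ Finset.range (k + 2), ((k + 1).choose i : ℝ) * ((M - i) * a i) :=
    Finset.sum_congr rfl fun i hi => by rw [h i (by have := Finset.mem_range.1 hi; omega)]
  have e1 : ∑ i ∈ Finset.range (k + 2), ((k + 1).choose i : ℝ) * ((N - i) * a (i + 1)) =
      N * binomialSum (fun i => a (i + 1)) (k + 1) -
        ((k : ℝ) + 1) * binomialSum (fun i => a (i + 1 + 1)) k := by
    rw [← sum_id_mul_choose_mul (fun i => a (i + 1)), binomialSum, Finset.mul_sum,
      ← Finset.sum_sub_distrib]
    exact Finset.sum_congr rfl fun i _ => by ring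
  have e2 : ∑ i ∈ Finset.range (k + 2), ((k + 1).choose i : ℝ) * ((M - i) * a i) =
      M * binomialSum a (k + 1) - ((k : ℝ) + 1) * binomialSum (fun i => a (i + 1)) k := by
    rw [← sum_id_mul_choose_mul a, binomialSum, Finset.mul_sum, ← Finset.sum_sub_distrib]
    exact Finset.sum_congr rfl fun i _ => by ring
  rw [e1, e2] at h0
  have s1 := binomialSum_succ a k
  have s2 := binomialSum_succ a (k + 1)
  have s3 := binomialSum_succ (fun i => a (i + 1)) k
  rw [s2, s3]
  rw [s3, s1] at h0
  rw [s1]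
  linear_combination h0

/-- The probability that `m` edges chosen uniformly from `N` and oriented at random avoid `l`
fixed directed edges. -/
noncomputable def avoidProb (N m l : ℕ) : ℝ :=
  binomialSum (fun i => ((N - i).choose m : ℝ) / (N.choose m : ℝ)) l / 2 ^ l

lemma choose_ratio_succ {N m i : ℕ} (hm : m ≤ N) (hi : i < N) :
    ((N : ℝ) - i) * (((N - (i + 1)).choose m : ℝ) / (N.choose m : ℝ)) =
      (((N : ℝ) - m) - i) * (((N - i).choose m : ℝ) / (N.choose m : ℝ)) := by
  obtain ⟨j, rfl⟩ : ∃ j, N = i + 1 + j := ⟨N - (i + 1), by omega⟩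
  rw [show i + 1 + j - (i + 1) = j by omega, show i + 1 + j - i = j + 1 by omega]
  have h := Nat.choose_mul_succ_eq j m
  have h' : (j.choose m : ℝ) * (j + 1) = ((j + 1).choose m : ℝ) * ((j : ℝ) + 1 - m) := by
    rcases le_or_gt m (j + 1) with hmj | hmj
    · have : ((j + 1 - m : ℕ) : ℝ) = (j : ℝ) + 1 - m := by rw [Nat.cast_sub hmj]; push_cast; ring
      rw [← this]; exact_mod_cast h
    · simp [Nat.choose_eq_zero_of_lt hmj, Nat.choose_eq_zero_of_lt (show j < m by omega)]
  push_cast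
  rw [← mul_div_assoc, ← mul_div_assoc]
  congr 1
  linear_combination h'

lemma avoidProb_recurrence {N m k : ℕ} (hm : m ≤ N) (hk : k + 1 < N) :
    2 * ((N : ℝ) - (k + 1)) * avoidProb N m (k + 2) =
      (2 * N - m - 3 * (k + 1)) * avoidProb N m (k + 1) + (k + 1) * avoidProb N m k := by
  have h := binomialSum_recurrence (fun i => ((N - i).choose m : ℝ) / (N.choose m : ℝ)) N
    ((N : ℝ) - m) k (fun i hi => choose_ratio_succ hm (by omega))
  unfold avoidProb
  rw [pow_succ, pow_succ]
  field_simp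
  linear_combination h

lemma avoidProb_zero {N m : ℕ} (hm : m ≤ N) : avoidProb N m 0 = 1 := by
  have : (N.choose m : ℝ) ≠ 0 := by exact_mod_cast (Nat.choose_pos hm).ne'
  simp [avoidProb, binomialSum, this]

lemma avoidProb_one {N m : ℕ} (hm : m ≤ N) (hN : 0 < N) :
    avoidProb N m 1 = 1 - (m : ℝ) / N / 2 := by
  have h0 : (N.choose m : ℝ) ≠ 0 := by exact_mod_cast (Nat.choose_pos hm).ne'
  have hN' : (N : ℝ) ≠ 0 := by exact_mod_cast hN.ne'
  have h := choose_ratio_succ (i := 0) hm hN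
  simp only [Nat.cast_zero, sub_zero, zero_add, Nat.sub_zero, div_self h0, mul_one] at h
  have h2 : ((N - 1).choose m : ℝ) / (N.choose m : ℝ) = ((N : ℝ) - m) / N := by
    rw [eq_div_iff hN']; linarith
  simp only [avoidProb, binomialSum, Finset.sum_range_succ, Finset.sum_range_zero]
  simp only [Nat.choose_zero_right, Nat.choose_self, Nat.sub_zero, div_self h0, h2]
  field_simp
  ring

lemma choose_ratio_le_pow {N m i : ℕ} (hm : m ≤ N) (hi : i ≤ N) :
    ((N - i).choose m : ℝ) / (N.choose m : ℝ) ≤ (1 - (m : ℝ) / N) ^ i := by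
  have h0 : (N.choose m : ℝ) ≠ 0 := by exact_mod_cast (Nat.choose_pos hm).ne'
  induction i with
  | zero => simp [div_self h0]
  | succ i ih =>
    have h := choose_ratio_succ (i := i) hm (by omega)
    have hiN : (i : ℝ) + 1 ≤ N := by exact_mod_cast hi
    have hN : (0 : ℝ) < N := by have : (0 : ℝ) ≤ i := i.cast_nonneg; linarith
    have hmN : (m : ℝ) ≤ N := by exact_mod_cast hm
    have hpos : (0 : ℝ) ≤ ((N - i).choose m : ℝ) / (N.choose m : ℝ) := by positivity
    have hp : 0 ≤ 1 - (m : ℝ) / N := by rw [sub_nonneg, div_le_one hN]; exact hmN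
    rw [pow_succ']
    refine le_trans ?_ (mul_le_mul_of_nonneg_left (ih (by omega)) hp)
    have hNi : (0 : ℝ) < N - i := by linarith
    rw [← mul_le_mul_iff_right₀ hNi, h, ← mul_assoc]
    refine mul_le_mul_of_nonneg_right ?_ hpos
    have : ((N : ℝ) - i) * (1 - (m : ℝ) / N) = N - m - i + i * ((m : ℝ) / N) := by
      field_simp; ring
    rw [this]
    have : (0 : ℝ) ≤ i * ((m : ℝ) / N) := by positivity
    linarith

lemma avoidProb_le_pow {N m l : ℕ} (hm : m ≤ N) (hl : l ≤ N) :
    avoidProb N m l ≤ (1 - (m : ℝ) / N / 2) ^ l := by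
  have h : (1 - (m : ℝ) / N / 2) = (1 - (m : ℝ) / N + 1) / 2 := by ring
  rw [h, div_pow, avoidProb, add_pow, binomialSum]
  refine div_le_div_of_nonneg_right (Finset.sum_le_sum fun i hi => ?_) (by positivity)
  rw [one_pow, mul_one, mul_comm]
  have := Finset.mem_range.1 hi
  exact mul_le_mul_of_nonneg_right (choose_ratio_le_pow hm (by omega)) (Nat.cast_nonneg _)

lemma binomialSum_nonneg {a : ℕ → ℝ} (ha : ∀ i, 0 ≤ a i) (l : ℕ) : 0 ≤ binomialSum a l :=
  Finset.sum_nonneg fun i _ => mul_nonneg (Nat.cast_nonneg _) (ha i)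

lemma half_avoidProb_le_succ (N m l : ℕ) : avoidProb N m l / 2 ≤ avoidProb N m (l + 1) := by
  unfold avoidProb
  rw [binomialSum_succ, pow_succ, div_div]
  gcongr
  have := binomialSum_nonneg (a := fun i => ((N - (i + 1)).choose m : ℝ) / (N.choose m : ℝ))
    (fun i => by positivity) l
  linarith

lemma avoidProb_pos {N m : ℕ} (hm : m ≤ N) (l : ℕ) : 0 < avoidProb N m l := by
  induction l with
  | zero => simp [avoidProb_zero hm]
  | succ l ih => linarith [half_avoidProb_le_succ N m l]

lemma card_edge (n : ℕ) : Fintype.card (Edge n) = n.choose 2 := by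
  have h1 : ((Finset.univ : Finset (Fin n × Fin n)).filter fun e => e.1 < e.2).card =
      ((Finset.univ : Finset (Fin n × Fin n)).filter fun e => e.2 < e.1).card :=
    Finset.card_bij (fun e _ => e.swap) (by simp) (fun _ _ _ _ h => Prod.swap_injective h)
      (fun e he => ⟨e.swap, by simpa using he, by simp⟩)
  have h2 : (Finset.univ : Finset (Fin n)).offDiag =
      ((Finset.univ : Finset (Fin n × Fin n)).filter fun e => e.1 < e.2) ∪
      ((Finset.univ : Finset (Fin n × Fin n)).filter fun e => e.2 < e.1) := by
    ext e; simp [Finset.mem_offDiag, lt_or_lt_iff_ne]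
  have h3 := congrArg Finset.card h2
  rw [Finset.card_union_of_disjoint, ← h1, Finset.offDiag_card] at h3
  · rw [Fintype.card_subtype, Nat.choose_two_right, Nat.mul_sub_one]
    simp at h3
    omega
  · rw [Finset.disjoint_filter]
    exact fun e _ h h' => lt_asymm h h'

open Polynomial in
/-- Generating function of the configurations avoiding prescribed orientations on `F`. -/
lemma sum_avoid_eq_coeff {n : ℕ} (m : ℕ) (F : Finset (Edge n)) (o : Edge n → Bool) :
    ∑ f : Config n, (if (∀ e ∈ F, f e ≠ some (o e)) ∧ edgeCount f = m then ((2 : ℝ) ^ m)⁻¹ else 0)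
      = ((1 + C (1 / 2 : ℝ) * X) ^ F.card * (1 + X) ^ (n.choose 2 - F.card)).coeff m := by
  classical
  let w : Edge n → Option Bool → ℝ[X] := fun e x =>
    if e ∈ F ∧ x = some (o e) then 0 else (if x.isSome then C (1 / 2 : ℝ) * X else 1)
  have h1 : ∀ f : Config n, ∏ e, w e (f e) =
      if ∀ e ∈ F, f e ≠ some (o e) then C ((1 / 2 : ℝ) ^ edgeCount f) * X ^ edgeCount f else 0 := by
    intro f
    split_ifs with h
    · have : ∀ e, w e (f e) = if (f e).isSome then C (1 / 2 : ℝ) * X else 1 := fun e =>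
        if_neg fun he => h e he.1 he.2
      rw [Finset.prod_congr rfl fun e _ => this e, Finset.prod_ite, Finset.prod_const,
        Finset.prod_const_one, mul_one, mul_pow, C_pow]
      rfl
    · push Not at h
      obtain ⟨e, he, hf⟩ := h
      exact Finset.prod_eq_zero (Finset.mem_univ e) (if_pos ⟨he, hf⟩)
  have h2 : ∀ e, ∑ x, w e x = if e ∈ F then 1 + C (1 / 2 : ℝ) * X else 1 + X := by
    intro e
    have hX : C (1 / 2 : ℝ) * X + C (1 / 2 : ℝ) * X = X := by
      rw [← add_mul, ← C_add]; norm_num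
    rw [Fintype.sum_option, Fintype.sum_bool]
    by_cases he : e ∈ F
    · rcases ho : o e <;> simp [w, he, ho]
    · simp only [w, he, false_and, if_false, Option.isSome_none, Option.isSome_some, if_true, hX]
      simp
  have h3 : ∑ f : Config n, ∏ e, w e (f e) =
      (1 + C (1 / 2 : ℝ) * X) ^ F.card * (1 + X) ^ (n.choose 2 - F.card) := by
    rw [← Fintype.prod_sum, Finset.prod_congr rfl fun e _ => h2 e, Finset.prod_ite,
      Finset.prod_const, Finset.prod_const]
    congr 2
    · congr 1; ext; simp
    · rw [← card_edge, ← Finset.card_compl]; congr 1; ext; simp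
  rw [← h3, finsetSum_coeff]
  refine Finset.sum_congr rfl fun f _ => ?_
  rw [h1]
  by_cases h : ∀ e ∈ F, f e ≠ some (o e)
  · rw [if_pos h, coeff_C_mul, coeff_X_pow]
    by_cases hm : edgeCount f = m
    · rw [if_pos ⟨h, hm⟩, if_pos hm.symm, hm, mul_one, one_div, inv_pow]
    · rw [if_neg fun hh => hm hh.2, if_neg (Ne.symm hm), mul_zero]
  · rw [if_neg fun hh => h hh.1, if_neg h, coeff_zero]

open Polynomial in
lemma coeff_avoid_polynomial {N l : ℕ} (m : ℕ) (hl : l ≤ N) :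
    ((1 + C (1 / 2 : ℝ) * X) ^ l * (1 + X) ^ (N - l)).coeff m =
      binomialSum (fun i => ((N - i).choose m : ℝ)) l / 2 ^ l := by
  have h : (1 + C (1 / 2 : ℝ) * X) = C (1 / 2 : ℝ) * (1 + (1 + X)) := by
    rw [mul_add, mul_add, mul_one, ← add_assoc, ← C_add]; norm_num
  rw [h, mul_pow, ← C_pow, mul_assoc, coeff_C_mul, add_pow, Finset.sum_mul, finsetSum_coeff,
    binomialSum, one_div, inv_pow, mul_comm, ← div_eq_mul_inv]
  congr 1
  refine Finset.sum_congr rfl fun i hi => ?_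
  have := Finset.mem_range.1 hi
  rw [one_pow, one_mul, mul_right_comm, ← pow_add, show l - i + (N - l) = N - i by omega,
    coeff_mul_natCast, coeff_one_add_X_pow, mul_comm]

lemma PrGnm_avoid {n m : ℕ} (F : Finset (Edge n)) (o : Edge n → Bool) :
    PrGnm n m {f | ∀ e ∈ F, f e ≠ some (o e)} = avoidProb (n.choose 2) m F.card := by
  classical
  have hF : F.card ≤ n.choose 2 := card_edge n ▸ Finset.card_le_univ F
  have h := sum_avoid_eq_coeff m F o
  rw [coeff_avoid_polynomial m hF] at h
  have h' : avoidProb (n.choose 2) m F.card =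
      (((n.choose 2).choose m : ℝ))⁻¹ *
        (binomialSum (fun i => ((n.choose 2 - i).choose m : ℝ)) F.card / 2 ^ F.card) := by
    rw [avoidProb, binomialSum, binomialSum, ← mul_div_assoc, Finset.mul_sum]
    congr 1
    exact Finset.sum_congr rfl fun i _ => by ring
  rw [h', ← h, Finset.mul_sum, PrGnm, prWeight]
  refine Finset.sum_congr rfl fun f _ => ?_
  rw [Set.indicator_apply, mul_inv]
  by_cases h2 : edgeCount f = m <;> simp [h2]

lemma PrGnm_mono {n m : ℕ} {E E' : Set (Config n)} (h : E ⊆ E') :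
    PrGnm n m E ≤ PrGnm n m E' := by
  refine Finset.sum_le_sum fun f _ => Set.indicator_le_indicator_of_subset h (fun f => ?_) f
  positivity

lemma PrGnm_nonneg {n m : ℕ} (E : Set (Config n)) : 0 ≤ PrGnm n m E :=
  Finset.sum_nonneg fun f _ => Set.indicator_nonneg (fun f _ => by positivity) f

lemma PrGnm_union_add_inter {n m : ℕ} (E E' : Set (Config n)) :
    PrGnm n m (E ∪ E') + PrGnm n m (E ∩ E') = PrGnm n m E + PrGnm n m E' := by
  simp only [PrGnm, prWeight, ← Finset.sum_add_distrib]
  refine Finset.sum_congr rfl fun f _ => ?_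
  exact congrFun (Set.indicator_union_add_inter _ E E') f

lemma PrGnm_biUnion_le {n m : ℕ} {ι : Type*} (T : Finset ι) (E : ι → Set (Config n)) :
    PrGnm n m (⋃ i ∈ T, E i) ≤ ∑ i ∈ T, PrGnm n m (E i) := by
  classical
  induction T using Finset.induction_on with
  | empty => simp [PrGnm, prWeight]
  | insert i T hi ih =>
    rw [Finset.set_biUnion_insert, Finset.sum_insert hi]
    have := PrGnm_union_add_inter (m := m) (E i) (⋃ i ∈ T, E i)
    linarith [PrGnm_nonneg (m := m) (E i ∩ ⋃ i ∈ T, E i)]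

lemma PrGnm_le_one {n m : ℕ} (hm : m ≤ n.choose 2) (E : Set (Config n)) : PrGnm n m E ≤ 1 := by
  have h := PrGnm_avoid (m := m) (∅ : Finset (Edge n)) (fun _ => true)
  rw [Finset.card_empty, avoidProb_zero hm] at h
  rw [← h]
  exact PrGnm_mono fun f _ => by simp

lemma abs_log_one_add_sub_le {d : ℝ} (hd : |d| ≤ 1 / 2) : |log (1 + d) - d| ≤ 2 * d ^ 2 := by
  obtain ⟨h1, h2⟩ := abs_le.1 hd
  have hpos : 0 < 1 + d := by linarith
  have hu := log_le_sub_one_of_pos hpos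
  have hl := one_sub_inv_le_log_of_pos hpos
  have : d - 2 * d ^ 2 ≤ 1 - (1 + d)⁻¹ := by
    rw [inv_eq_one_div, le_sub_iff_add_le, ← le_sub_iff_add_le', div_le_iff₀ hpos]
    nlinarith [sq_nonneg d, mul_nonneg (sq_nonneg d) (show 0 ≤ 1 + 2 * d by linarith)]
  rw [abs_le]
  constructor <;> nlinarith [sq_nonneg d]

section Ratio

variable {N m : ℕ}

lemma avoidProb_succ_div_ge (hm : m ≤ N) (l : ℕ) :
    1 / 2 ≤ avoidProb N m (l + 1) / avoidProb N m l := by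
  rw [le_div_iff₀ (avoidProb_pos hm l)]
  linarith [half_avoidProb_le_succ N m l]

lemma avoidProb_ratio_recurrence {k : ℕ} (hm : m ≤ N) (hk : k + 1 < N) :
    2 * ((N : ℝ) - (k + 1)) *
        (avoidProb N m (k + 2) / avoidProb N m (k + 1) - (1 - (m : ℝ) / N / 2)) =
      (k + 1) * ((avoidProb N m (k + 1) / avoidProb N m k)⁻¹ - 1 - (m : ℝ) / N) := by
  have h := avoidProb_recurrence hm hk
  have h1 := (avoidProb_pos hm (k + 1)).ne'
  have hN : (N : ℝ) ≠ 0 := by have : N ≠ 0 := by omega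
                              exact_mod_cast this
  rw [inv_div]
  field_simp
  linear_combination N * h

lemma abs_avoidProb_ratio_sub_le {l : ℕ} (hm : m ≤ N) (hl : 2 * l ≤ N) (hN : 0 < N) :
    |avoidProb N m (l + 1) / avoidProb N m l - (1 - (m : ℝ) / N / 2)| ≤ 2 * l / N := by
  have hN' : (0 : ℝ) < N := by exact_mod_cast hN
  have hp0 : 0 ≤ (m : ℝ) / N := by positivity
  have hp1 : (m : ℝ) / N ≤ 1 := by rw [div_le_one hN']; exact_mod_cast hm
  cases l with
  | zero => simp [avoidProb_zero hm, avoidProb_one hm hN]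
  | succ k =>
    have h := avoidProb_ratio_recurrence (k := k) hm (by omega)
    set R := avoidProb N m (k + 1 + 1) / avoidProb N m (k + 1) - (1 - (m : ℝ) / N / 2) with hR
    have hr := avoidProb_succ_div_ge hm k
    set r := avoidProb N m (k + 1) / avoidProb N m k
    have hu : r⁻¹ ≤ 2 := by
      rw [inv_le_comm₀ (by linarith) two_pos]; linarith
    have hu0 : 0 ≤ r⁻¹ := inv_nonneg.2 (by linarith)
    have hl' : 2 * ((k : ℝ) + 1) ≤ N := by exact_mod_cast hl
    have hk : (0 : ℝ) ≤ (k : ℝ) + 1 := by positivity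
    have hD : |2 * ((N : ℝ) - (k + 1)) * R| ≤ ((k : ℝ) + 1) * 2 := by
      rw [h, abs_mul, abs_of_nonneg hk]
      exact mul_le_mul_of_nonneg_left (abs_le.2 ⟨by linarith, by linarith⟩) hk
    rw [abs_mul, abs_of_nonneg (by linarith : (0 : ℝ) ≤ 2 * ((N : ℝ) - (k + 1)))] at hD
    rw [le_div_iff₀ hN']
    push_cast
    nlinarith [abs_nonneg R]

lemma abs_avoidProb_ratio_sub_linear_le {l : ℕ} (hm : m ≤ N) (hl : 2 * l ≤ N) (hN : 0 < N) :
    |avoidProb N m (l + 1) / avoidProb N m l - (1 - (m : ℝ) / N / 2) *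
        (1 - ((m : ℝ) / N) * (1 - (m : ℝ) / N) / (2 - (m : ℝ) / N) ^ 2 * (l / N))| ≤
      9 * ((l : ℝ) / N) ^ 2 := by
  have hN' : (0 : ℝ) < N := by exact_mod_cast hN
  cases l with
  | zero => simp [avoidProb_zero hm, avoidProb_one hm hN]
  | succ k =>
    have h := avoidProb_ratio_recurrence (k := k) hm (by omega)
    have h1 := abs_avoidProb_ratio_sub_le (l := k) hm (by omega) hN
    have hr := avoidProb_succ_div_ge hm k
    have hp0 : 0 ≤ (m : ℝ) / N := by positivity
    have hp1 : (m : ℝ) / N ≤ 1 := by rw [div_le_one hN']; exact_mod_cast hm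
    have hl' : 2 * ((k : ℝ) + 1) ≤ N := by exact_mod_cast hl
    set R := avoidProb N m (k + 1 + 1) / avoidProb N m (k + 1)
    set r := avoidProb N m (k + 1) / avoidProb N m k
    set p := (m : ℝ) / N
    push_cast
    set L := (k : ℝ) + 1 with hL
    have hL0 : 0 < L := by positivity
    set e := r⁻¹ - (1 - p / 2)⁻¹ with he
    have he' : |e| ≤ 8 * (L / N) := by
      have hx : 1 / 2 ≤ 1 - p / 2 := by linarith
      rw [he, inv_sub_inv (by linarith) (by linarith), abs_div, abs_sub_comm,
        div_le_iff₀ (abs_pos.2 (mul_pos (by linarith) (by linarith)).ne'),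
        abs_of_pos (mul_pos (by linarith : 0 < r) (by linarith))]
      have h4 : 1 / 4 ≤ r * (1 - p / 2) := by nlinarith
      refine h1.trans ?_
      have : 2 * (k : ℝ) / N ≤ 2 * (L / N) := by
        rw [← mul_div_assoc]; gcongr; linarith
      have h5 : 0 ≤ L / N := by positivity
      nlinarith
    have hD : (0 : ℝ) < N - L := by linarith
    have hp2 : (2 - p) ≠ 0 := by linarith
    have hq : p * (1 - p) ≤ 1 / 4 := by nlinarith [sq_nonneg (p - 1 / 2)]
    have hq0 : 0 ≤ p * (1 - p) := mul_nonneg hp0 (by linarith)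
    set c := p * (1 - p) / (2 * (2 - p)) with hc
    have hc0 : 0 ≤ c := div_nonneg hq0 (by linarith)
    have hc1 : c ≤ 1 / 4 := by
      rw [hc, div_le_iff₀ (by linarith)]; linarith
    have hxc : (1 - p / 2) * (1 - p * (1 - p) / (2 - p) ^ 2 * (L / N)) =
        (1 - p / 2) - c * (L / N) := by
      rw [hc]; field_simp
    have hu : r⁻¹ - 1 - p = e - 2 * c := by
      have : (1 - p / 2)⁻¹ = 2 / (2 - p) := by
        rw [show 1 - p / 2 = (2 - p) / 2 by ring, inv_div]
      rw [he, hc, this]; field_simp; ring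
    rw [hu] at h
    rw [hxc]
    have hR : (R - (1 - p / 2 - c * (L / N))) = (L / N) * (e / 2 - c * (L / N)) * (N / (N - L)) := by
      have hD' := hD.ne'
      field_simp
      field_simp at h
      linear_combination N * h
    have hb : (N : ℝ) / (N - L) ≤ 2 := by rw [div_le_iff₀ hD]; linarith
    have hb0 : (0 : ℝ) ≤ N / (N - L) := by positivity
    have hLN : 0 ≤ L / N := by positivity
    have h6 : |e / 2 - c * (L / N)| ≤ 9 / 2 * (L / N) := by
      obtain ⟨e1, e2⟩ := abs_le.1 he'
      rw [abs_le]; constructor <;> nlinarith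
    rw [hR, abs_mul, abs_mul, abs_of_nonneg hb0, abs_of_nonneg hLN]
    calc (L / N) * |e / 2 - c * (L / N)| * (N / (N - L))
        ≤ (L / N) * (9 / 2 * (L / N)) * 2 := by gcongr
      _ = 9 * (L / N) ^ 2 := by ring

lemma abs_log_avoidProb_ratio_le {l : ℕ} (hm : m ≤ N) (hl : 8 * l ≤ N) (hN : 0 < N) :
    |log (avoidProb N m (l + 1)) - log (avoidProb N m l) - log (1 - (m : ℝ) / N / 2) +
        ((m : ℝ) / N) * (1 - (m : ℝ) / N) / (2 - (m : ℝ) / N) ^ 2 * (l / N)| ≤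
      50 * ((l : ℝ) / N) ^ 2 := by
  have hN' : (0 : ℝ) < N := by exact_mod_cast hN
  have h1 := abs_avoidProb_ratio_sub_le (l := l) hm (by omega) hN
  have h2 := abs_avoidProb_ratio_sub_linear_le (l := l) hm (by omega) hN
  have hr := avoidProb_succ_div_ge hm l
  have hp1 : (m : ℝ) / N ≤ 1 := by rw [div_le_one hN']; exact_mod_cast hm
  rw [← log_div (avoidProb_pos hm _).ne' (avoidProb_pos hm _).ne']
  set R := avoidProb N m (l + 1) / avoidProb N m l
  set x := 1 - (m : ℝ) / N / 2 with hx
  have hx0 : 1 / 2 ≤ x := by linarith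
  rw [← log_div (by linarith) (by linarith)]
  set c := ((m : ℝ) / N) * (1 - (m : ℝ) / N) / (2 - (m : ℝ) / N) ^ 2
  rw [mul_div_assoc] at h1
  have ht0 : 0 ≤ (l : ℝ) / N := by positivity
  have ht1 : (l : ℝ) / N ≤ 1 / 8 := by
    rw [div_le_iff₀ hN']
    have : 8 * (l : ℝ) ≤ N := by exact_mod_cast hl
    linarith
  set t := (l : ℝ) / N
  have hxpos : 0 < x := by linarith
  have hd : |R / x - 1| ≤ 4 * t := by
    rw [div_sub_one hxpos.ne', abs_div, abs_of_pos hxpos, div_le_iff₀ hxpos]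
    nlinarith
  have hd2 : |R / x - 1 + c * t| ≤ 18 * t ^ 2 := by
    have : R / x - 1 + c * t = (R - x * (1 - c * t)) / x := by field_simp; ring
    rw [this, abs_div, abs_of_pos hxpos, div_le_iff₀ hxpos]
    nlinarith [sq_nonneg t]
  have hlog := abs_log_one_add_sub_le (d := R / x - 1) (by linarith)
  rw [add_sub_cancel] at hlog
  have hsq : (R / x - 1) ^ 2 ≤ (4 * t) ^ 2 := sq_le_sq' (abs_le.1 hd).1 (abs_le.1 hd).2
  have := abs_add_le (log (R / x) - (R / x - 1)) (R / x - 1 + c * t)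
  have e : log (R / x) - (R / x - 1) + (R / x - 1 + c * t) = log (R / x) + c * t := by ring
  rw [e] at this
  nlinarith

lemma abs_log_avoidProb_le {l : ℕ} (hm : m ≤ N) (hl : 8 * l ≤ N) (hN : 0 < N) :
    |log (avoidProb N m l) - l * log (1 - (m : ℝ) / N / 2) +
        ((m : ℝ) / N) * (1 - (m : ℝ) / N) / (2 - (m : ℝ) / N) ^ 2 * (l * (l - 1) / (2 * N))| ≤
      50 * ((l : ℝ) ^ 3 / N ^ 2) := by
  have hN' : (0 : ℝ) < N := by exact_mod_cast hN
  induction l with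
  | zero => simp [avoidProb_zero hm]
  | succ l ih =>
    have h1 := ih (by omega)
    have h2 := abs_log_avoidProb_ratio_le (l := l) hm (by omega) hN
    set c := ((m : ℝ) / N) * (1 - (m : ℝ) / N) / (2 - (m : ℝ) / N) ^ 2
    have h3 := (abs_add_le _ _).trans (add_le_add h1 h2)
    have e : (50 : ℝ) * (l ^ 3 / N ^ 2) + 50 * (l / N) ^ 2 ≤
        50 * (((l + 1 : ℕ) : ℝ) ^ 3 / N ^ 2) := by
      rw [div_pow, ← mul_add, ← add_div]
      gcongr
      push_cast
      have : (0 : ℝ) ≤ l := l.cast_nonneg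
      nlinarith [sq_nonneg (l : ℝ)]
    refine le_trans (le_of_eq ?_) (h3.trans e)
    congr 1
    push_cast
    field_simp
    ring

end Ratio

/-- The avoidance probability of `n + 1` directed edges in a graph on `n + 2` vertices, up to a
factor tending to `1` uniformly in the edge density. -/
lemma abs_log_avoidProb_choose_two_le {n m : ℕ} (hm : m ≤ (n + 2).choose 2) (hn : 14 ≤ n) :
    |log (avoidProb ((n + 2).choose 2) m (n + 1)) -
        (n + 1) * log (1 - (m : ℝ) / ((n + 2).choose 2 : ℝ) / 2) +
        ((m : ℝ) / ((n + 2).choose 2 : ℝ)) * (1 - (m : ℝ) / ((n + 2).choose 2 : ℝ)) /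
          (2 - (m : ℝ) / ((n + 2).choose 2 : ℝ)) ^ 2| ≤ 201 / ((n : ℝ) + 2) := by
  have hN : (((n + 2).choose 2 : ℕ) : ℝ) = ((n : ℝ) + 2) * (n + 1) / 2 := by
    rw [Nat.cast_choose_two]; push_cast; ring
  have hN0 : 0 < (n + 2).choose 2 := Nat.choose_pos (by omega)
  have h8 : 8 * (n + 1) ≤ (n + 2).choose 2 := by
    have : (8 : ℝ) * (n + 1) ≤ ((n + 2).choose 2 : ℕ) := by
      rw [hN]
      have : (14 : ℝ) ≤ n := by exact_mod_cast hn
      nlinarith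
    exact_mod_cast this
  have h := abs_log_avoidProb_le hm h8 hN0
  have hN' : (0 : ℝ) < ((n + 2).choose 2 : ℕ) := by exact_mod_cast hN0
  have hp1 : (m : ℝ) / ((n + 2).choose 2 : ℝ) ≤ 1 := by
    rw [div_le_one hN']; exact_mod_cast hm
  have hp0 : 0 ≤ (m : ℝ) / ((n + 2).choose 2 : ℝ) := by positivity
  set p := (m : ℝ) / ((n + 2).choose 2 : ℝ)
  have hc1 : p * (1 - p) / (2 - p) ^ 2 ≤ 1 / 4 := by
    rw [div_le_iff₀ (by nlinarith)]; nlinarith [sq_nonneg (p - 1 / 2)]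
  have hc0 : 0 ≤ p * (1 - p) / (2 - p) ^ 2 :=
    div_nonneg (mul_nonneg hp0 (by linarith)) (sq_nonneg _)
  set c := p * (1 - p) / (2 - p) ^ 2
  rw [hN] at h
  push_cast at h
  have hn2 : (0 : ℝ) < (n : ℝ) + 2 := by positivity
  have hn1 : (0 : ℝ) < (n : ℝ) + 1 := by positivity
  have e1 : c * (((n : ℝ) + 1) * (n + 1 - 1) / (2 * ((n + 2) * (n + 1) / 2))) =
      c - c * (2 / ((n : ℝ) + 2)) := by field_simp; ring
  have e2 : 50 * (((n : ℝ) + 1) ^ 3 / ((n + 2) * (n + 1) / 2) ^ 2) ≤ 200 / ((n : ℝ) + 2) := by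
    have : 50 * (((n : ℝ) + 1) ^ 3 / ((n + 2) * (n + 1) / 2) ^ 2) =
      200 / ((n : ℝ) + 2) * ((n + 1) / (n + 2)) := by field_simp; ring
    rw [this]
    refine mul_le_of_le_one_right (by positivity) ?_
    rw [div_le_one hn2]; linarith
  have e3 : c * (2 / ((n : ℝ) + 2)) ≤ 1 / ((n : ℝ) + 2) := by
    rw [mul_div_assoc', div_le_div_iff_of_pos_right hn2]; linarith
  have e4 : 0 ≤ c * (2 / ((n : ℝ) + 2)) := by positivity
  rw [e1] at h
  have e5 : 201 / ((n : ℝ) + 2) = 200 / ((n : ℝ) + 2) + 1 / ((n : ℝ) + 2) := by ring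
  rw [e5]
  obtain ⟨h1, h2⟩ := abs_le.1 (h.trans e2)
  rw [abs_le]
  constructor <;> linarith

/-- Edges with exactly one endpoint in `S`. -/
def cutEdges {n : ℕ} (S : Finset (Fin n)) : Finset (Edge n) :=
  Finset.univ.filter fun e => ¬ (e.1.1 ∈ S ↔ e.1.2 ∈ S)

lemma mem_cutEdges {n : ℕ} {S : Finset (Fin n)} {e : Edge n} :
    e ∈ cutEdges S ↔ ¬ (e.1.1 ∈ S ↔ e.1.2 ∈ S) := by
  simp [cutEdges]

lemma card_cutEdges {n : ℕ} (S : Finset (Fin n)) :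
    (cutEdges S).card = S.card * (n - S.card) := by
  have h : (cutEdges S).card = (S ×ˢ Sᶜ).card := by
    refine Finset.card_bij (fun e _ => if e.1.1 ∈ S then e.1 else e.1.swap) ?_ ?_ ?_
    · intro e he
      rw [mem_cutEdges] at he
      split_ifs with h <;> simp [Finset.mem_product] <;> tauto
    · rintro ⟨⟨u, v⟩, huv⟩ he ⟨⟨u', v'⟩, huv'⟩ he' h
      simp only at h huv huv'
      split_ifs at h <;> simp only [Prod.mk.injEq, Prod.swap_prod_mk] at h <;>
        obtain ⟨rfl, rfl⟩ := h
      · rfl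
      · exact absurd huv huv'.asymm
      · exact absurd huv huv'.asymm
      · rfl
    · rintro ⟨u, v⟩ h
      rw [Finset.mem_product, Finset.mem_compl] at h
      simp only at h
      have hne : u ≠ v := fun huv => h.2 (huv ▸ h.1)
      rcases lt_or_gt_of_ne hne with huv | huv
      · exact ⟨⟨(u, v), huv⟩, by simp [mem_cutEdges, h.1, h.2], by simp [h.1]⟩
      · exact ⟨⟨(v, u), huv⟩, by simp [mem_cutEdges, h.1, h.2], by simp [h.2]⟩
  rw [h, Finset.card_product, Finset.card_compl, Fintype.card_fin]

/-- Configurations without a directed edge leaving `S`. -/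
def noEdgeOut {n : ℕ} (S : Finset (Fin n)) : Set (Config n) :=
  {f | ∀ e ∈ cutEdges S, f e ≠ some (decide (e.1.1 ∈ S))}

lemma mem_noEdgeOut {n : ℕ} {S : Finset (Fin n)} {f : Config n} :
    f ∈ noEdgeOut S ↔ ∀ u ∈ S, ∀ v, DirEdge f u v → v ∈ S := by
  constructor
  · rintro h u hu v (⟨huv, hf⟩ | ⟨huv, hf⟩) <;> by_contra hv
    · exact h ⟨(u, v), huv⟩ (by simp [mem_cutEdges, hu, hv]) (by simp [hf, hu])
    · exact h ⟨(v, u), huv⟩ (by simp [mem_cutEdges, hu, hv]) (by simp [hf, hv])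
  · rintro h ⟨⟨u, v⟩, huv⟩ he hf
    rw [mem_cutEdges] at he
    simp only at he hf
    by_cases hu : u ∈ S
    · have := h u hu v (Or.inl ⟨huv, by simpa [hu] using hf⟩)
      tauto
    · have hv : v ∈ S := by tauto
      exact hu (h v hv u (Or.inr ⟨huv, by simpa [hu] using hf⟩))

lemma PrGnm_noEdgeOut {n m : ℕ} (S : Finset (Fin n)) :
    PrGnm n m (noEdgeOut S) = avoidProb (n.choose 2) m (S.card * (n - S.card)) := by
  rw [← card_cutEdges, ← PrGnm_avoid (cutEdges S) fun e => decide (e.1.1 ∈ S)]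
  rfl

lemma noEdgeOut_subset_not_reaches {n : ℕ} {S : Finset (Fin n)} {s a : Fin n}
    (hs : s ∈ S) (ha : a ∉ S) : noEdgeOut S ⊆ {f | ¬ Reaches f s a} := by
  intro f hf hr
  rw [mem_noEdgeOut] at hf
  refine ha ?_
  unfold Reaches at hr
  induction hr with
  | refl => exact hs
  | tail _ h ih => exact hf _ (by_contra fun hh => hh (by simpa using ih)) _ h

lemma not_reaches_subset {n : ℕ} (s a : Fin n) :
    {f : Config n | ¬ Reaches f s a} ⊆
      ⋃ W ∈ ((Finset.univ.erase s).erase a).powerset, noEdgeOut (insert s W) := by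
  classical
  intro f hf
  rw [Set.mem_ofPred_eq] at hf
  have hs : Reaches f s s := Relation.ReflTransGen.refl
  set S := Finset.univ.filter fun u => Reaches f s u with hS
  have hSs : insert s (S.erase s) = S := Finset.insert_erase (by simp [hS, hs])
  refine Set.mem_biUnion (x := S.erase s) ?_ ?_
  · simp only [Finset.coe_powerset, Set.mem_preimage, Set.mem_powerset_iff, Finset.coe_subset]
    intro u hu
    have hu' := Finset.mem_erase.1 hu
    simp only [hS, Finset.mem_filter, Finset.mem_univ, true_and] at hu'
    simp only [Finset.mem_erase, Finset.mem_univ, and_true]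
    exact ⟨fun h => hf (h ▸ hu'.2), hu'.1⟩
  · rw [hSs, mem_noEdgeOut]
    intro u hu v huv
    simp only [hS, Finset.mem_filter, Finset.mem_univ, true_and] at hu ⊢
    exact Relation.ReflTransGen.tail hu huv

lemma PrGnm_not_reaches_le {n m : ℕ} {s a : Fin (n + 2)} (hsa : s ≠ a) :
    PrGnm (n + 2) m {f | ¬ Reaches f s a} ≤
      ∑ j ∈ Finset.range (n + 1),
        (n.choose j : ℝ) * avoidProb ((n + 2).choose 2) m ((j + 1) * (n + 1 - j)) := by
  have hcard : ((Finset.univ.erase s).erase a).card = n := by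
    rw [Finset.card_erase_of_mem (by simp [hsa.symm]), Finset.card_erase_of_mem (by simp)]
    simp
  refine (PrGnm_mono (not_reaches_subset s a)).trans ((PrGnm_biUnion_le _ _).trans (le_of_eq ?_))
  have h : ∀ W ∈ ((Finset.univ.erase s).erase a).powerset,
      PrGnm (n + 2) m (noEdgeOut (insert s W)) =
        avoidProb ((n + 2).choose 2) m ((W.card + 1) * (n + 1 - W.card)) := by
    intro W hW
    have hs : s ∉ W := fun h => by simpa using Finset.mem_powerset.1 hW h
    rw [PrGnm_noEdgeOut, Finset.card_insert_of_notMem hs]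
    congr 2
    omega
  rw [Finset.sum_congr rfl h, Finset.sum_powerset_apply_card
    (fun j => avoidProb ((n + 2).choose 2) m ((j + 1) * (n + 1 - j))), hcard]
  simp

lemma noEdgeOut_inter_subset {n : ℕ} {s a : Fin n} (hsa : s ≠ a) :
    noEdgeOut {s} ∩ noEdgeOut (Finset.univ.erase a) ⊆
      {f | ∀ e ∈ cutEdges {s} ∪ cutEdges (Finset.univ.erase a),
        f e ≠ some (decide (e.1.1 = s ∨ e.1.2 = a))} := by
  rintro f ⟨h1, h2⟩ e he
  rcases Finset.mem_union.1 he with h | h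
  · have : e.1.1 ∈ ({s} : Finset (Fin n)) ↔ (e.1.1 = s ∨ e.1.2 = a) := by
      rw [mem_cutEdges] at h
      simp only [Finset.mem_singleton] at h ⊢
      refine ⟨Or.inl, ?_⟩
      rintro (h' | h')
      · exact h'
      · by_contra h3
        refine h ⟨fun q => absurd q h3, fun q => absurd (q.symm.trans h') hsa⟩
    simpa only [this] using h1 e h
  · have : e.1.1 ∈ Finset.univ.erase a ↔ (e.1.1 = s ∨ e.1.2 = a) := by
      rw [mem_cutEdges] at h
      simp only [Finset.mem_erase, Finset.mem_univ, and_true] at h ⊢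
      constructor
      · exact fun h' => Or.inr (by_contra fun h3 => h ⟨fun _ => h3, fun _ => h'⟩)
      · rintro (h' | h')
        · exact h' ▸ hsa
        · exact fun h3 => h ⟨fun q => absurd h3 q, fun q => absurd h' q⟩
    simpa only [this] using h2 e h

lemma card_cutEdges_inter_le {n : ℕ} {s a : Fin n} (hsa : s ≠ a) :
    (cutEdges {s} ∩ cutEdges (Finset.univ.erase a)).card ≤ 1 := by
  have key : ∀ {u v : Fin n}, (¬(u = s ↔ v = s) ∧ ¬(u ≠ a ↔ v ≠ a)) →
      (u = s ∧ v = a) ∨ (u = a ∧ v = s) := by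
    intro u v h
    have h1 : u = s → u ≠ a := fun h => h ▸ hsa
    have h2 : v = s → v ≠ a := fun h => h ▸ hsa
    tauto
  rw [Finset.card_le_one]
  rintro ⟨⟨u, v⟩, huv⟩ h ⟨⟨u', v'⟩, huv'⟩ h'
  simp only [Finset.mem_inter, mem_cutEdges, Finset.mem_singleton, Finset.mem_erase,
    Finset.mem_univ, and_true] at h h' huv huv'
  rcases key h with ⟨rfl, rfl⟩ | ⟨rfl, rfl⟩ <;> rcases key h' with ⟨rfl, rfl⟩ | ⟨rfl, rfl⟩
  · rfl
  · exact absurd huv huv'.asymm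
  · exact absurd huv huv'.asymm
  · rfl

lemma PrGnm_not_reaches_ge {n m : ℕ} (hm : m ≤ (n + 2).choose 2) {s a : Fin (n + 2)}
    (hsa : s ≠ a) :
    2 * avoidProb ((n + 2).choose 2) m (n + 1) -
        (1 - (m : ℝ) / ((n + 2).choose 2 : ℝ) / 2) ^ (2 * n + 1) ≤
      PrGnm (n + 2) m {f | ¬ Reaches f s a} := by
  classical
  have hN : (0 : ℝ) < ((n + 2).choose 2 : ℕ) := by exact_mod_cast Nat.choose_pos (by omega)
  have hp1 : (m : ℝ) / ((n + 2).choose 2 : ℝ) ≤ 1 := by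
    rw [div_le_one hN]; exact_mod_cast hm
  have hp0 : 0 ≤ (m : ℝ) / ((n + 2).choose 2 : ℝ) := by positivity
  set A : Finset (Fin (n + 2)) := {s}
  set B : Finset (Fin (n + 2)) := Finset.univ.erase a
  have hA : PrGnm (n + 2) m (noEdgeOut A) = avoidProb ((n + 2).choose 2) m (n + 1) := by
    rw [PrGnm_noEdgeOut]; congr 1; simp [A]
  have hBc : B.card = n + 1 := by simp [B]
  have hB : PrGnm (n + 2) m (noEdgeOut B) = avoidProb ((n + 2).choose 2) m (n + 1) := by
    rw [PrGnm_noEdgeOut, hBc]; congr 1; simp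
  have hsub : noEdgeOut A ∪ noEdgeOut B ⊆ {f | ¬ Reaches f s a} :=
    Set.union_subset (noEdgeOut_subset_not_reaches (by simp [A]) (by simp [A, hsa.symm]))
      (noEdgeOut_subset_not_reaches (by simp [B, hsa]) (by simp [B]))
  have hcardI : (cutEdges A ∩ cutEdges B).card ≤ 1 := card_cutEdges_inter_le hsa
  have hcardU : 2 * n + 1 ≤ (cutEdges A ∪ cutEdges B).card := by
    have h := Finset.card_union_add_card_inter (cutEdges A) (cutEdges B)
    rw [card_cutEdges A, card_cutEdges B, hBc, show A.card = 1 from Finset.card_singleton s] at h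
    have : (n + 1) * (n + 2 - (n + 1)) = n + 1 := by simp
    omega
  have hI : PrGnm (n + 2) m (noEdgeOut A ∩ noEdgeOut B) ≤
      (1 - (m : ℝ) / ((n + 2).choose 2 : ℝ) / 2) ^ (2 * n + 1) := by
    refine (PrGnm_mono (noEdgeOut_inter_subset hsa)).trans ?_
    rw [PrGnm_avoid (cutEdges A ∪ cutEdges B) fun e => decide (e.1.1 = s ∨ e.1.2 = a)]
    refine (avoidProb_le_pow hm (card_edge (n + 2) ▸ Finset.card_le_univ _)).trans ?_
    exact pow_le_pow_of_le_one (by linarith) (by linarith) hcardU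
  have hU := PrGnm_union_add_inter (m := m) (noEdgeOut A) (noEdgeOut B)
  linarith [PrGnm_mono (m := m) hsub]

lemma choose_mul_pow_le {y : ℝ} (hy0 : 0 < y) (hy1 : y < 1) {w i : ℕ} (hiw : 2 * i ≤ w)
    (hw : ((w : ℝ) + 2) * y ^ (w / 2) ≤ 1 / 2) :
    ((w + 2).choose (i + 1) : ℝ) * y ^ (i * (w - i)) ≤ ((w : ℝ) + 2) * (1 / 2) ^ i := by
  have h1 : ((w + 2).choose (i + 1) : ℝ) ≤ ((w : ℝ) + 2) ^ (i + 1) := by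
    exact_mod_cast Nat.choose_le_pow (w + 2) (i + 1)
  have h2 : y ^ (i * (w - i)) ≤ (y ^ (w / 2)) ^ i := by
    rw [← pow_mul, mul_comm (w / 2)]
    exact pow_le_pow_of_le_one hy0.le hy1.le (Nat.mul_le_mul_left _ (by omega))
  calc ((w + 2).choose (i + 1) : ℝ) * y ^ (i * (w - i))
      ≤ ((w : ℝ) + 2) ^ (i + 1) * (y ^ (w / 2)) ^ i := by gcongr
    _ = ((w : ℝ) + 2) * (((w : ℝ) + 2) * y ^ (w / 2)) ^ i := by rw [mul_pow, pow_succ', mul_assoc]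
    _ ≤ ((w : ℝ) + 2) * (1 / 2) ^ i := by gcongr

lemma sum_choose_mul_pow_le {y : ℝ} (hy0 : 0 < y) (hy1 : y < 1) {w : ℕ}
    (hw : ((w : ℝ) + 2) * y ^ (w / 2) ≤ 1 / 2) :
    ∑ i ∈ Finset.range (w + 1), ((w + 2).choose (i + 1) : ℝ) * y ^ (i * (w - i)) ≤
      4 * ((w : ℝ) + 2) := by
  have hgeom : ∑ i ∈ Finset.range (w + 1), (1 / 2 : ℝ) ^ i ≤ 2 := sum_geometric_two_le _
  have hterm : ∀ i ∈ Finset.range (w + 1),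
      ((w + 2).choose (i + 1) : ℝ) * y ^ (i * (w - i)) ≤
        ((w : ℝ) + 2) * ((1 / 2) ^ i + (1 / 2) ^ (w - i)) := by
    intro i hi
    have hi' := Finset.mem_range.1 hi
    rw [mul_add]
    rcases le_total (2 * i) w with h | h
    · have := choose_mul_pow_le hy0 hy1 h hw
      have h' : (0 : ℝ) ≤ ((w : ℝ) + 2) * (1 / 2) ^ (w - i) := by positivity
      linarith
    · have := choose_mul_pow_le hy0 hy1 (i := w - i) (by omega) hw
      have h' : (0 : ℝ) ≤ ((w : ℝ) + 2) * (1 / 2) ^ i := by positivity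
      rw [show w - (w - i) = i by omega, mul_comm (w - i),
        Nat.choose_symm_of_eq_add (show w + 2 = (w - i + 1) + (i + 1) by omega)] at this
      linarith
  refine (Finset.sum_le_sum hterm).trans ?_
  rw [← Finset.mul_sum, Finset.sum_add_distrib]
  have hrefl := Finset.sum_range_reflect (fun i => (1 / 2 : ℝ) ^ i) (w + 1)
  simp only [Nat.add_sub_cancel] at hrefl
  rw [hrefl]
  have : (0 : ℝ) < (w : ℝ) + 2 := by positivity
  nlinarith

lemma eventually_add_two_mul_pow_half_le {y : ℝ} (hy0 : 0 < y) (hy1 : y < 1) :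
    ∀ᶠ w : ℕ in atTop, ((w : ℝ) + 2) * y ^ (w / 2) ≤ 1 / 2 := by
  have h1 : Tendsto (fun t : ℕ => 2 * ((t : ℝ) * y ^ t) + 3 * y ^ t) atTop (nhds 0) := by
    have a := tendsto_self_mul_const_pow_of_lt_one hy0.le hy1
    have b := tendsto_pow_atTop_nhds_zero_of_lt_one hy0.le hy1
    simpa using (a.const_mul 2).add (b.const_mul 3)
  have h2 : Tendsto (fun w : ℕ => w / 2) atTop atTop := Nat.tendsto_div_const_atTop (by norm_num)
  filter_upwards [(h1.comp h2).eventually_le_const (show (0 : ℝ) < 1 / 2 by norm_num)] with w hw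
  refine le_trans ?_ hw
  have : (w : ℝ) ≤ 2 * ((w / 2 : ℕ) : ℝ) + 1 := by
    have : w ≤ 2 * (w / 2) + 1 := by omega
    exact_mod_cast this
  have hp : 0 ≤ y ^ (w / 2) := by positivity
  simp only [Function.comp]
  nlinarith

lemma abs_PrGnm_not_reaches_sub_le {y : ℝ} (hy0 : 0 < y) (hy1 : y < 1) {w m : ℕ}
    (hw : ((w : ℝ) + 2) * y ^ (w / 2) ≤ 1 / 2) (hm : m ≤ (w + 2 + 2).choose 2)
    (hy : 1 - (m : ℝ) / ((w + 2 + 2).choose 2 : ℝ) / 2 ≤ y)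
    {s a : Fin (w + 2 + 2)} (hsa : s ≠ a) :
    |PrGnm (w + 2 + 2) m {f | ¬ Reaches f s a} -
        2 * avoidProb ((w + 2 + 2).choose 2) m (w + 2 + 1)| ≤
      64 * ((w : ℝ) + 2 + 2) *
        (1 - (m : ℝ) / ((w + 2 + 2).choose 2 : ℝ) / 2) ^ (2 * (w + 2 + 2)) := by
  have hN : (0 : ℝ) < ((w + 2 + 2).choose 2 : ℕ) := by exact_mod_cast Nat.choose_pos (by omega)
  have hp1 : (m : ℝ) / ((w + 2 + 2).choose 2 : ℝ) ≤ 1 := by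
    rw [div_le_one hN]; exact_mod_cast hm
  have hp0 : 0 ≤ (m : ℝ) / ((w + 2 + 2).choose 2 : ℝ) := by positivity
  have hlow := PrGnm_not_reaches_ge hm hsa
  have hup := PrGnm_not_reaches_le (m := m) hsa
  have hpow := fun l hl => avoidProb_le_pow (l := l) hm hl
  set x := 1 - (m : ℝ) / ((w + 2 + 2).choose 2 : ℝ) / 2 with hx
  have hx0 : 1 / 2 ≤ x := by linarith
  have hx1 : x ≤ 1 := by linarith
  have hxp : ∀ k l : ℕ, x ^ k ≤ 2 ^ l * x ^ (k + l) := by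
    intro k l
    have h1 : 1 ≤ (2 * x) ^ l := one_le_pow₀ (by linarith)
    have h2 : 0 ≤ x ^ k := pow_nonneg (by linarith) _
    calc x ^ k ≤ x ^ k * (2 * x) ^ l := le_mul_of_one_le_right h2 h1
      _ = 2 ^ l * x ^ (k + l) := by rw [mul_pow, pow_add, mul_left_comm]
  have hX : 0 ≤ x ^ (2 * (w + 2 + 2)) := pow_nonneg (by linarith) _
  have hw0 : (0 : ℝ) ≤ w := w.cast_nonneg
  rw [abs_le]
  constructor
  · have := hxp (2 * (w + 2) + 1) 3
    rw [show 2 * (w + 2) + 1 + 3 = 2 * (w + 2 + 2) by ring] at this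
    nlinarith
  · rw [Finset.sum_range_succ, Finset.sum_range_succ'] at hup
    simp only [Nat.choose_self, Nat.choose_zero_right, Nat.cast_one, one_mul, zero_add,
      Nat.sub_zero] at hup
    rw [show w + 2 + 1 - (w + 2) = 1 by omega, mul_one] at hup
    have hmid : ∑ i ∈ Finset.range (w + 1), ((w + 2).choose (i + 1) : ℝ) *
        avoidProb ((w + 2 + 2).choose 2) m ((i + 1 + 1) * (w + 2 + 1 - (i + 1))) ≤
        ∑ i ∈ Finset.range (w + 1), 16 * x ^ (2 * (w + 2 + 2)) *
          (((w + 2).choose (i + 1) : ℝ) * y ^ (i * (w - i))) := by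
      refine Finset.sum_le_sum fun i hi => ?_
      obtain ⟨j, rfl⟩ : ∃ j, w = i + j := ⟨w - i, by have := Finset.mem_range.1 hi; omega⟩
      rw [show i + j + 2 + 1 - (i + 1) = j + 2 by omega, show i + j - i = j by omega]
      have hle : (i + 1 + 1) * (j + 2) ≤ (i + j + 2 + 2).choose 2 := by
        have : (((i + 1 + 1) * (j + 2) : ℕ) : ℝ) ≤ ((i + j + 2 + 2).choose 2 : ℕ) := by
          rw [Nat.cast_choose_two]
          push_cast
          nlinarith [sq_nonneg ((i : ℝ) - j), (i.cast_nonneg : (0 : ℝ) ≤ i),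
            (j.cast_nonneg : (0 : ℝ) ≤ j)]
        exact_mod_cast this
      have h1 : x ^ ((i + 1 + 1) * (j + 2)) ≤ 16 * x ^ (2 * (i + j + 2 + 2)) * y ^ (i * j) := by
        have h2 := hxp ((i + 1 + 1) * (j + 2)) 4
        rw [show (i + 1 + 1) * (j + 2) + 4 = 2 * (i + j + 2 + 2) + i * j by ring, pow_add] at h2
        have h3 : x ^ (i * j) ≤ y ^ (i * j) := pow_le_pow_left₀ (by linarith) hy _
        have h4 := mul_le_mul_of_nonneg_left h3 hX
        linarith
      calc _ ≤ ((i + j + 2).choose (i + 1) : ℝ) *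
            (16 * x ^ (2 * (i + j + 2 + 2)) * y ^ (i * j)) := by
              gcongr
              exact (hpow _ hle).trans h1
        _ = _ := by ring
    rw [← Finset.mul_sum] at hmid
    have hsum := mul_le_mul_of_nonneg_left (sum_choose_mul_pow_le hy0 hy1 hw)
      (show 0 ≤ 16 * x ^ (2 * (w + 2 + 2)) by positivity)
    nlinarith

/-- Suppose `m = m(n) → ∞`, let `p(n) := m(n)/C(n,2)` and assume
`liminf p(n) > 0`. For distinct vertices `s, a` of `⃗G(n,m)` (graphs on `n + 2`
vertices) and any family of `n - 1` directed edges (a set `F` of pairs with chosen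
orientations `o`, so `q(n-1;n,m)` is its avoidance probability),
`P(s ↛ a) = 2 q(n-1;n,m) + O(n (1-p/2)^(2n))`, and consequently
`P(s ↛ a) ∼ 2 (1-p/2)^(n-1) exp(-p(1-p)/(2-p)²)`. -/
theorem gnm_not_reach_asymp
    (m : ℕ → ℕ) (hmN : ∀ n, m n ≤ Nat.choose (n + 2) 2)
    (hm : Filter.Tendsto m Filter.atTop Filter.atTop)
    (hliminf : 0 < Filter.liminf
      (fun n : ℕ => (m n : ℝ) / (Nat.choose (n + 2) 2 : ℝ)) Filter.atTop)
    (s a : (n : ℕ) → Fin (n + 2)) (hsa : ∀ n, s n ≠ a n)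
    (F : (n : ℕ) → Finset (Edge (n + 2))) (hF : ∀ n, (F n).card = n + 1)
    (o : (n : ℕ) → Edge (n + 2) → Bool) :
    (∃ C : ℝ, 0 < C ∧ ∀ n : ℕ,
        |PrGnm (n + 2) (m n) {f | ¬ Reaches f (s n) (a n)} -
            2 * PrGnm (n + 2) (m n) {f | ∀ e ∈ F n, f e ≠ some (o n e)}| ≤
          C * ((n : ℝ) + 2) *
            (1 - ((m n : ℝ) / (Nat.choose (n + 2) 2 : ℝ)) / 2) ^ (2 * (n + 2))) ∧
    Filter.Tendsto (fun n : ℕ =>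
        PrGnm (n + 2) (m n) {f | ¬ Reaches f (s n) (a n)} /
          (2 * (1 - ((m n : ℝ) / (Nat.choose (n + 2) 2 : ℝ)) / 2) ^ (n + 1) *
            Real.exp (-(((m n : ℝ) / (Nat.choose (n + 2) 2 : ℝ)) *
                (1 - (m n : ℝ) / (Nat.choose (n + 2) 2 : ℝ))) /
              (2 - (m n : ℝ) / (Nat.choose (n + 2) 2 : ℝ)) ^ 2)))
      Filter.atTop (nhds 1) := by
  have hN : ∀ n : ℕ, (0 : ℝ) < ((n + 2).choose 2 : ℕ) := fun n => by
    exact_mod_cast Nat.choose_pos (by omega)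
  set p : ℕ → ℝ := fun n => (m n : ℝ) / ((n + 2).choose 2 : ℝ) with hp
  have hp0 : ∀ n, 0 ≤ p n := fun n => by positivity
  have hp1 : ∀ n, p n ≤ 1 := fun n => by
    rw [hp, div_le_one (hN n)]; exact_mod_cast hmN n
  obtain ⟨d, hd0, hd⟩ := exists_between hliminf
  have hpd : ∀ᶠ n in atTop, d < p n :=
    eventually_lt_of_lt_liminf hd (isBoundedUnder_of ⟨0, hp0⟩)
  have hd1 : d < 1 := by
    obtain ⟨n, hn⟩ := hpd.exists
    exact hn.trans_le (hp1 n)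
  set y : ℝ := 1 - d / 2 with hy
  have hy0 : 0 < y := by linarith
  have hy1 : y < 1 := by linarith
  have hQ : ∀ n, PrGnm (n + 2) (m n) {f | ∀ e ∈ F n, f e ≠ some (o n e)} =
      avoidProb ((n + 2).choose 2) (m n) (n + 1) := fun n => by rw [PrGnm_avoid, hF]
  have hbound : ∀ᶠ n in atTop, |PrGnm (n + 2) (m n) {f | ¬ Reaches f (s n) (a n)} -
      2 * PrGnm (n + 2) (m n) {f | ∀ e ∈ F n, f e ≠ some (o n e)}| ≤
        64 * ((n : ℝ) + 2) * (1 - p n / 2) ^ (2 * (n + 2)) := by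
    obtain ⟨w₀, hw₀⟩ := eventually_atTop.1 (eventually_add_two_mul_pow_half_le hy0 hy1)
    filter_upwards [hpd, eventually_ge_atTop (w₀ + 2)] with n hn hnw
    obtain ⟨w, rfl⟩ : ∃ w, n = w + 2 := ⟨n - 2, by omega⟩
    rw [hQ]
    have h := abs_PrGnm_not_reaches_sub_le hy0 hy1 (hw₀ w (by omega)) (hmN (w + 2))
      (show 1 - p (w + 2) / 2 ≤ y by linarith) (hsa (w + 2))
    push_cast
    exact h
  constructor
  · obtain ⟨n₀, hn₀⟩ := eventually_atTop.1 hbound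
    refine ⟨64 + 3 * 2 ^ (2 * (n₀ + 2)), by positivity, fun n => ?_⟩
    have hx : 1 / 2 ≤ 1 - p n / 2 := by linarith [hp1 n]
    have hX : 0 ≤ ((n : ℝ) + 2) * (1 - p n / 2) ^ (2 * (n + 2)) :=
      mul_nonneg (by positivity) (pow_nonneg (by linarith) _)
    rw [mul_assoc]
    rcases le_total n₀ n with hn | hn
    · refine (hn₀ n hn).trans ?_
      rw [mul_assoc]
      exact mul_le_mul_of_nonneg_right (by linarith [show (0 : ℝ) < 2 ^ (2 * (n₀ + 2)) by positivity])
        hX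
    · have h1 := PrGnm_le_one (hmN n) {f | ¬ Reaches f (s n) (a n)}
      have h2 := PrGnm_nonneg (m := m n) {f | ¬ Reaches f (s n) (a n)}
      have h3 := PrGnm_le_one (hmN n) {f | ∀ e ∈ F n, f e ≠ some (o n e)}
      have h4 := PrGnm_nonneg (m := m n) {f | ∀ e ∈ F n, f e ≠ some (o n e)}
      have h5 : (1 : ℝ) ≤ 2 ^ (2 * (n₀ + 2)) * (1 - p n / 2) ^ (2 * (n + 2)) := by
        calc (1 : ℝ) ≤ (2 * (1 - p n / 2)) ^ (2 * (n + 2)) := one_le_pow₀ (by linarith)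
          _ = 2 ^ (2 * (n + 2)) * (1 - p n / 2) ^ (2 * (n + 2)) := mul_pow _ _ _
          _ ≤ _ := by
            refine mul_le_mul_of_nonneg_right ?_ (pow_nonneg (by linarith) _)
            exact pow_le_pow_right₀ one_le_two (by omega)
      have h6 : |PrGnm (n + 2) (m n) {f | ¬ Reaches f (s n) (a n)} -
          2 * PrGnm (n + 2) (m n) {f | ∀ e ∈ F n, f e ≠ some (o n e)}| ≤ 3 :=
        abs_le.2 ⟨by linarith, by linarith⟩
      refine h6.trans ?_
      have h7 : (0 : ℝ) ≤ n := n.cast_nonneg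
      have h8 : (2 : ℝ) ^ (2 * (n₀ + 2)) * (1 - p n / 2) ^ (2 * (n + 2)) ≤
          2 ^ (2 * (n₀ + 2)) * (((n : ℝ) + 2) * (1 - p n / 2) ^ (2 * (n + 2))) := by
        gcongr
        exact le_mul_of_one_le_left (pow_nonneg (by linarith) _) (by linarith)
      nlinarith
  · set c : ℕ → ℝ := fun n => p n * (1 - p n) / (2 - p n) ^ 2 with hc
    have hc1 : ∀ n, c n ≤ 1 := fun n => by
      have := hp1 n
      have := hp0 n
      rw [hc, div_le_one (by nlinarith)]
      nlinarith
    have hmain : Tendsto (fun n : ℕ => avoidProb ((n + 2).choose 2) (m n) (n + 1) /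
        ((1 - p n / 2) ^ (n + 1) * exp (-c n))) atTop (nhds 1) := by
      have hlog : Tendsto (fun n : ℕ => log (avoidProb ((n + 2).choose 2) (m n) (n + 1)) -
          (n + 1) * log (1 - p n / 2) + c n) atTop (nhds 0) := by
        refine squeeze_zero_norm' (a := fun n : ℕ => 201 / ((n : ℝ) + 2)) ?_ ?_
        · filter_upwards [eventually_ge_atTop 14] with n hn
          exact abs_log_avoidProb_choose_two_le (hmN n) hn
        · exact tendsto_const_nhds.div_atTop
            (tendsto_atTop_add_const_right _ _ tendsto_natCast_atTop_atTop)
      have hexp := (continuous_exp.tendsto 0).comp hlog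
      rw [exp_zero] at hexp
      refine hexp.congr fun n => ?_
      have hx : 0 < 1 - p n / 2 := by linarith [hp1 n]
      have hlx : ((n : ℝ) + 1) * log (1 - p n / 2) = log ((1 - p n / 2) ^ (n + 1)) := by
        rw [log_pow]; push_cast; ring
      simp only [Function.comp]
      rw [exp_add, hlx, exp_sub, exp_log (avoidProb_pos (hmN n) _), exp_log (pow_pos hx _),
        exp_neg, ← div_div, div_inv_eq_mul]
    have herr : Tendsto (fun n : ℕ => (PrGnm (n + 2) (m n) {f | ¬ Reaches f (s n) (a n)} -
        2 * avoidProb ((n + 2).choose 2) (m n) (n + 1)) /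
        (2 * (1 - p n / 2) ^ (n + 1) * exp (-c n))) atTop (nhds 0) := by
      refine squeeze_zero_norm' (a := fun n : ℕ => 32 * exp 1 * (((n : ℝ) + 2) * y ^ n)) ?_ ?_
      · filter_upwards [hbound, hpd] with n hn hnd
        rw [hQ] at hn
        have hx : 0 < 1 - p n / 2 := by linarith [hp1 n]
        have hxy : 1 - p n / 2 ≤ y := by linarith
        have hx1 : 1 - p n / 2 ≤ 1 := by linarith [hp0 n]
        have hD : 0 < 2 * (1 - p n / 2) ^ (n + 1) * exp (-c n) := by positivity
        rw [norm_eq_abs, abs_div, abs_of_pos hD, div_le_iff₀ hD]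
        refine hn.trans ?_
        have h1 : 1 ≤ exp 1 * exp (-c n) := by
          rw [← exp_add]; exact one_le_exp (by linarith [hc1 n])
        have h2 : (1 - p n / 2) ^ (n + 3) ≤ y ^ n :=
          (pow_le_pow_of_le_one hx.le hx1 (by omega)).trans (pow_le_pow_left₀ hx.le hxy n)
        calc 64 * ((n : ℝ) + 2) * (1 - p n / 2) ^ (2 * (n + 2))
            = 64 * ((n : ℝ) + 2) * ((1 - p n / 2) ^ (n + 1) * (1 - p n / 2) ^ (n + 3)) * 1 := by
              ring
          _ ≤ 64 * ((n : ℝ) + 2) * ((1 - p n / 2) ^ (n + 1) * y ^ n) *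
              (exp 1 * exp (-c n)) := by gcongr
          _ = _ := by ring
      · have h1 := tendsto_self_mul_const_pow_of_lt_one hy0.le hy1
        have h2 := tendsto_pow_atTop_nhds_zero_of_lt_one hy0.le hy1
        have h3 := (h1.add (h2.const_mul 2)).const_mul (32 * exp 1)
        simp only [mul_zero, add_zero] at h3
        refine h3.congr fun n => ?_
        ring
    have hsum := herr.add hmain
    rw [zero_add] at hsum
    refine hsum.congr fun n => ?_
    have hx : 0 < 1 - p n / 2 := by linarith [hp1 n]
    have hcn : -(p n * (1 - p n)) / (2 - p n) ^ 2 = -c n := neg_div _ _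
    change _ = PrGnm (n + 2) (m n) {f | ¬ Reaches f (s n) (a n)} /
      (2 * (1 - p n / 2) ^ (n + 1) * exp (-(p n * (1 - p n)) / (2 - p n) ^ 2))
    rw [hcn]
    field_simp
    ring
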